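/- (Proposition 7.1: unique solvability up to horizontal translation.) Suppose the network is quasi-triangulated. Then for any boundary data gⁱ ∈ ℝ² (i ∈ I), the truncated dissipation functional Q̂ attains its minimum on (ℝ²)^N, and its set of minimizers is exactly {(T*¹ + t·e₁, …, T*^N + t·e₁) : t ∈ ℝ} for any fixed minimizer (T*¹, …, T*^N); i.e., the minimizer is unique up to adding a common horizontal translation t·e₁ to every component. -/

import Mathlib

noncomputable section

/-- Dot product on ℝ² (represented as `Fin 2 → ℝ`). -/
def dot (v w : Fin 2 → ℝ) : ℝ := v 0 * w 0 + v 1 * w 1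

/-- First standard basis vector of ℝ². -/
def e1 : Fin 2 → ℝ := ![1, 0]

/-- Second standard basis vector of ℝ². -/
def e2 : Fin 2 → ℝ := ![0, 1]

/-- A weighted linear least-squares functional with finitely many terms attains its minimum. -/
theorem exists_forall_weighted_leastSquares_le {κ V : Type*} [Fintype κ] [AddCommGroup V]
    [Module ℝ V] (L : κ → V →ₗ[ℝ] ℝ) (b w : κ → ℝ) (hw : ∀ k, 0 ≤ w k) :
    ∃ x, ∀ y, ∑ k, w k * (L k x - b k) ^ 2 ≤ ∑ k, w k * (L k y - b k) ^ 2 := by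
  let A : V →ₗ[ℝ] EuclideanSpace ℝ κ :=
    (WithLp.linearEquiv 2 ℝ (κ → ℝ)).symm.toLinearMap ∘ₗ
      LinearMap.pi fun k => √(w k) • L k
  let c : EuclideanSpace ℝ κ := WithLp.toLp 2 fun k => √(w k) * b k
  have hA : ∀ y, ∑ k, w k * (L k y - b k) ^ 2 = ‖c - A y‖ ^ 2 := by
    intro y
    rw [EuclideanSpace.norm_sq_eq]
    refine Finset.sum_congr rfl fun k _ => ?_
    have hk : (c - A y) k = √(w k) * (b k - L k y) := by
      simp [A, c, mul_sub]
    rw [hk, Real.norm_eq_abs, sq_abs, mul_pow, Real.sq_sqrt (hw k)]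
    ring
  obtain ⟨_, ⟨x, rfl⟩, hx⟩ := (LinearMap.range A).exists_norm_eq_iInf_of_complete_subspace
    (Submodule.complete_of_finiteDimensional _) c
  refine ⟨x, fun y => ?_⟩
  rw [hA, hA, hx]
  gcongr
  · exact Real.iInf_nonneg fun _ => norm_nonneg _
  · exact ciInf_le (f := fun z : LinearMap.range A => ‖c - z‖)
      ⟨0, Set.forall_mem_range.2 fun _ => norm_nonneg _⟩ ⟨A y, y, rfl⟩

/-- Two minimizers of a weighted linear least-squares functional agree on every term of
positive weight. -/
theorem weighted_leastSquares_minimizers_agree {κ V : Type*} [Fintype κ] [AddCommGroup V]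
    [Module ℝ V] (L : κ → V →ₗ[ℝ] ℝ) (b w : κ → ℝ) (hw : ∀ k, 0 ≤ w k) {x x' : V}
    (hx : ∀ y, ∑ k, w k * (L k x - b k) ^ 2 ≤ ∑ k, w k * (L k y - b k) ^ 2)
    (hx' : ∀ y, ∑ k, w k * (L k x' - b k) ^ 2 ≤ ∑ k, w k * (L k y - b k) ^ 2)
    {k : κ} (hk : 0 < w k) : L k x = L k x' := by
  have hmid : ∑ k, w k * (L k ((1 / 2 : ℝ) • (x + x')) - b k) ^ 2 =
      (1 / 2) * ∑ k, w k * (L k x - b k) ^ 2 + (1 / 2) * ∑ k, w k * (L k x' - b k) ^ 2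
        - (1 / 4) * ∑ k, w k * (L k x - L k x') ^ 2 := by
    simp only [Finset.mul_sum, ← Finset.sum_add_distrib, ← Finset.sum_sub_distrib]
    refine Finset.sum_congr rfl fun k _ => ?_
    rw [map_smul, map_add, smul_eq_mul]
    ring
  have hle : w k * (L k x - L k x') ^ 2 ≤ ∑ k, w k * (L k x - L k x') ^ 2 :=
    Finset.single_le_sum (f := fun k => w k * (L k x - L k x') ^ 2)
      (fun k _ => mul_nonneg (hw k) (sq_nonneg _)) (Finset.mem_univ k)
  have h₀ : w k * (L k x - L k x') ^ 2 ≤ 0 := by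
    linarith [hx ((1 / 2 : ℝ) • (x + x')), hx' ((1 / 2 : ℝ) • (x + x'))]
  have hsq : (L k x - L k x') ^ 2 = 0 :=
    le_antisymm (nonpos_of_mul_nonpos_right h₀ hk) (sq_nonneg _)
  exact sub_eq_zero.1 (pow_eq_zero_iff two_ne_zero |>.1 hsq)

/-- Taking the dot product with a fixed vector, as a linear functional. -/
def dotRight (w : Fin 2 → ℝ) : (Fin 2 → ℝ) →ₗ[ℝ] ℝ where
  toFun v := dot v w
  map_add' u v := by simp only [dot, Pi.add_apply]; ring
  map_smul' c v := by simp only [dot, Pi.smul_apply, smul_eq_mul, RingHom.id_apply]; ring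

/-- A vector orthogonal to two linearly independent vectors of the plane vanishes. -/
theorem eq_zero_of_dot_eq_zero {v a b : Fin 2 → ℝ} (hab : LinearIndependent ℝ ![a, b])
    (ha : dot v a = 0) (hb : dot v b = 0) : v = 0 := by
  have hspan : Submodule.span ℝ (Set.range ![a, b]) = ⊤ :=
    hab.span_eq_top_of_card_eq_finrank (by simp)
  have hle : Submodule.span ℝ (Set.range ![a, b]) ≤ LinearMap.ker (dotRight v) := by
    rw [Submodule.span_le]
    rintro _ ⟨i, rfl⟩
    fin_cases i
    · simpa [dotRight, dot, mul_comm] using ha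
    · simpa [dotRight, dot, mul_comm] using hb
  have hvv : dot v v = 0 := hle (hspan ▸ Submodule.mem_top : v ∈ _)
  have h0 : v 0 = 0 := by unfold dot at hvv; nlinarith [sq_nonneg (v 0), sq_nonneg (v 1)]
  have h1 : v 1 = 0 := by unfold dot at hvv; nlinarith [sq_nonneg (v 0), sq_nonneg (v 1)]
  ext i
  fin_cases i
  · exact h0
  · exact h1

/-- On a quasi-triangulated network, a displacement that stretches no edge and is horizontal on
the lower boundary is a common horizontal translation. -/
theorem exists_eq_smul_e1_of_quasiTriangulated {ι : Type*} {adj : ι → ι → Prop}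
    {q : ι → ι → Fin 2 → ℝ} {Iminus : Finset ι} (hne : Iminus.Nonempty)
    (hconn : ∀ i ∈ Iminus, ∀ j ∈ Iminus, ∃ (m : ℕ) (p : Fin (m + 1) → ι),
      p 0 = i ∧ p (Fin.last m) = j ∧ (∀ k, p k ∈ Iminus) ∧
      ∀ k : Fin m, adj (p k.castSucc) (p k.succ) ∧
        dot (q (p k.castSucc) (p k.succ)) e1 ≠ 0)
    (henum : ∃ (m : ℕ) (v : Fin m → ι), (∀ x, x ∉ Iminus ↔ ∃ k, v k = x) ∧
      ∀ k : Fin m, ∃ j1 j2 : ι,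
        adj (v k) j1 ∧ adj (v k) j2 ∧
        (j1 ∈ Iminus ∨ ∃ l, l < k ∧ v l = j1) ∧
        (j2 ∈ Iminus ∨ ∃ l, l < k ∧ v l = j2) ∧
        LinearIndependent ℝ ![q (v k) j1, q (v k) j2])
    {D : ι → Fin 2 → ℝ} (hedge : ∀ i j, adj i j → dot (D i - D j) (q i j) = 0)
    (hbd : ∀ i ∈ Iminus, D i 1 = 0) : ∃ t : ℝ, ∀ i, D i = t • e1 := by
  obtain ⟨i₀, hi₀⟩ := hne
  have hminus : ∀ j ∈ Iminus, D j = D i₀ 0 • e1 := by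
    intro j hj
    obtain ⟨m, p, hp0, hpm, hpI, hp⟩ := hconn i₀ hi₀ j hj
    have hpath : ∀ k, D (p k) 0 = D i₀ 0 := by
      intro k
      induction k using Fin.induction with
      | zero => rw [hp0]
      | succ k ih =>
        obtain ⟨hadj, hq⟩ := hp k
        have h := hedge _ _ hadj
        simp only [dot, e1, Pi.sub_apply, hbd _ (hpI _), sub_self, zero_mul, add_zero,
          Matrix.cons_val_zero, Matrix.cons_val_one, mul_one, mul_zero] at h hq
        have := (mul_eq_zero.1 h).resolve_right hq
        linarith
    ext i
    fin_cases i
    · simpa [e1, hpm] using hpath (Fin.last m)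
    · simpa [e1] using hbd j hj
  obtain ⟨m, v, hv, hstep⟩ := henum
  have hall : ∀ k, D (v k) = D i₀ 0 • e1 := by
    intro k
    induction k using WellFoundedLT.induction with
    | ind k ih =>
      obtain ⟨j1, j2, ha1, ha2, hj1, hj2, hli⟩ := hstep k
      have hknown : ∀ j, (j ∈ Iminus ∨ ∃ l, l < k ∧ v l = j) → D j = D i₀ 0 • e1 := by
        rintro j (hj | ⟨l, hl, rfl⟩)
        · exact hminus j hj
        · exact ih l hl
      have h1 := hedge _ _ ha1
      have h2 := hedge _ _ ha2
      rw [hknown _ hj1] at h1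
      rw [hknown _ hj2] at h2
      exact sub_eq_zero.1 (eq_zero_of_dot_eq_zero hli h1 h2)
  refine ⟨D i₀ 0, fun i => ?_⟩
  by_cases hi : i ∈ Iminus
  · exact hminus i hi
  · obtain ⟨k, rfl⟩ := (hv i).1 hi
    exact hall k

/-- Proposition 7.1: for a quasi-triangulated network and any
boundary data, Q̂ attains its minimum, and the set of minimizers is exactly the
set of common horizontal translates of any fixed minimizer. -/
theorem stmt11
    (N : ℕ)
    (adj : Fin N → Fin N → Prop) [DecidableRel adj]
    (hsymm : ∀ i j, adj i j → adj j i)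
    (hirrefl : ∀ i, ¬ adj i i)
    (q : Fin N → Fin N → Fin 2 → ℝ)
    (hq_unit : ∀ i j, adj i j → dot (q i j) (q i j) = 1)
    (hq_anti : ∀ i j, adj i j → q j i = -q i j)
    (Iplus Iminus : Finset (Fin N))
    (hdisj : Disjoint Iplus Iminus)
    (qb : Fin N → Fin 2 → ℝ)
    (hqb_plus : ∀ i ∈ Iplus, qb i = e2)
    (hqb_minus : ∀ i ∈ Iminus, qb i = -e2)
    (Csp : Fin N → Fin N → ℝ)
    (hCsp_symm : ∀ i j, Csp i j = Csp j i)
    (hCsp_pos : ∀ i j, adj i j → 0 < Csp i j)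
    (Cb : Fin N → ℝ)
    (hCb_pos : ∀ i ∈ Iplus ∪ Iminus, 0 < Cb i)
    (g : Fin N → Fin 2 → ℝ)
    -- quasi-triangulation, condition (i)
    (hne : Iminus.Nonempty)
    (hconn : ∀ i ∈ Iminus, ∀ j ∈ Iminus, ∃ (m : ℕ) (p : Fin (m + 1) → Fin N),
      p 0 = i ∧ p (Fin.last m) = j ∧ (∀ k, p k ∈ Iminus) ∧
      ∀ k : Fin m, adj (p k.castSucc) (p k.succ) ∧
        dot (q (p k.castSucc) (p k.succ)) e1 ≠ 0)
    -- quasi-triangulation, condition (ii)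
    (henum : ∃ (m : ℕ) (v : Fin m → Fin N), Function.Injective v ∧
      (∀ x : Fin N, x ∉ Iminus ↔ ∃ k, v k = x) ∧
      ∀ k : Fin m, ∃ j1 j2 : Fin N,
        adj (v k) j1 ∧ adj (v k) j2 ∧
        (j1 ∈ Iminus ∨ ∃ l, l < k ∧ v l = j1) ∧
        (j2 ∈ Iminus ∨ ∃ l, l < k ∧ v l = j2) ∧
        LinearIndependent ℝ ![q (v k) j1, q (v k) j2])
    (Qhat : (Fin N → Fin 2 → ℝ) → ℝ)
    (hQhat : ∀ T, Qhat T =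
      (1/2) * ∑ i, ∑ j, (if adj i j then Csp i j * (dot (T i - T j) (q i j))^2 else 0)
      + ∑ i ∈ Iplus ∪ Iminus, Cb i * (dot (T i - g i) (qb i))^2) :
    (∃ Tstar : Fin N → Fin 2 → ℝ, ∀ T, Qhat Tstar ≤ Qhat T) ∧
    (∀ Tstar : Fin N → Fin 2 → ℝ, (∀ T, Qhat Tstar ≤ Qhat T) →
      ∀ T : Fin N → Fin 2 → ℝ,
        ((∀ T', Qhat T ≤ Qhat T') ↔ ∃ t : ℝ, ∀ i, T i = Tstar i + t • e1)) := by
  let L : (Fin N × Fin N) ⊕ Fin N → (Fin N → Fin 2 → ℝ) →ₗ[ℝ] ℝ :=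
    Sum.elim
      (fun e => dotRight (q e.1 e.2) ∘ₗ
        ((LinearMap.proj e.1 : (Fin N → Fin 2 → ℝ) →ₗ[ℝ] Fin 2 → ℝ) - LinearMap.proj e.2))
      (fun i => dotRight (qb i) ∘ₗ LinearMap.proj i)
  let b : (Fin N × Fin N) ⊕ Fin N → ℝ := Sum.elim (fun _ => 0) (fun i => dot (g i) (qb i))
  let w : (Fin N × Fin N) ⊕ Fin N → ℝ :=
    Sum.elim (fun e => if adj e.1 e.2 then (1 / 2) * Csp e.1 e.2 else 0)
      (fun i => if i ∈ Iplus ∪ Iminus then Cb i else 0)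
  have hw : ∀ k, 0 ≤ w k := by
    rintro (⟨i, j⟩ | i)
    · by_cases h : adj i j
      · simpa [w, h] using (hCsp_pos i j h).le
      · simp [w, h]
    · by_cases h : i ∈ Iplus ∪ Iminus
      · simpa only [w, Sum.elim_inr, if_pos h] using (hCb_pos i h).le
      · simp only [w, Sum.elim_inr, if_neg h, le_refl]
  have hQ : ∀ T, Qhat T = ∑ k, w k * (L k T - b k) ^ 2 := by
    intro T
    rw [hQhat, Fintype.sum_sum_type, Fintype.sum_prod_type, Finset.mul_sum]
    congr 1
    · refine Finset.sum_congr rfl fun i _ => ?_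
      rw [Finset.mul_sum]
      refine Finset.sum_congr rfl fun j _ => ?_
      by_cases h : adj i j
      · simp [w, L, b, h, dotRight, mul_assoc]
      · simp [w, h]
    · rw [← Finset.sum_subset (Finset.subset_univ (Iplus ∪ Iminus))]
      · refine Finset.sum_congr rfl fun i hi => ?_
        simp only [w, L, b, Sum.elim_inr, if_pos hi, dotRight, dot, LinearMap.comp_apply,
          LinearMap.proj_apply, LinearMap.coe_mk, AddHom.coe_mk, Pi.sub_apply]
        ring
      · intro i _ hi
        simp only [w, Sum.elim_inr, if_neg hi, zero_mul]
  refine ⟨?_, fun Tstar hstar T => ⟨fun hT => ?_, ?_⟩⟩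
  · simp only [hQ]
    exact exists_forall_weighted_leastSquares_le L b w hw
  · simp only [hQ] at hstar hT
    have hagree := fun k => weighted_leastSquares_minimizers_agree L b w hw hT hstar (k := k)
    obtain ⟨m, v, -, hv⟩ := henum
    obtain ⟨t, ht⟩ := exists_eq_smul_e1_of_quasiTriangulated (D := fun i => T i - Tstar i)
      hne hconn ⟨m, v, hv⟩
      (by
        intro i j h
        have := hagree (Sum.inl (i, j)) (by simpa [w, h] using hCsp_pos i j h)
        simp only [L, Sum.elim_inl, dotRight, dot, LinearMap.comp_apply, LinearMap.sub_apply,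
          LinearMap.proj_apply, LinearMap.coe_mk, AddHom.coe_mk, Pi.sub_apply] at this
        simp only [dot, Pi.sub_apply]
        linarith)
      (by
        intro i hi
        have hi' : i ∈ Iplus ∪ Iminus := Finset.mem_union_right _ hi
        have := hagree (Sum.inr i) (by
          simpa only [w, Sum.elim_inr, if_pos hi'] using hCb_pos i hi')
        simp [L, dotRight, dot, hqb_minus i hi, e2] at this
        simp [this])
    exact ⟨t, fun i => by rw [← ht i]; abel⟩
  · rintro ⟨t, ht⟩ T'
    have hbdry : ∀ i ∈ Iplus ∪ Iminus, qb i 0 = 0 := by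
      intro i hi
      rcases Finset.mem_union.1 hi with h | h
      · simp [hqb_plus i h, e2]
      · simp [hqb_minus i h, e2]
    have heq : Qhat T = Qhat Tstar := by
      rw [hQhat, hQhat]
      congr 1
      · simp only [ht, add_sub_add_right_eq_sub]
      · refine Finset.sum_congr rfl fun i hi => ?_
        simp [ht, dot, hbdry i hi, show e1 1 = 0 from rfl]
    exact heq ▸ hstar T'
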